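/- Let ℓ be a prime, let a and b be odd integers, and let n ≥ 3 be an odd integer such that a² + ℓ b² = 2^{n+2}. Then b² ≡ 1 (mod 16), and a² ≡ 1 (mod 16) if and only if ℓ ≡ 15 (mod 16). -/

import Mathlib

open scoped NumberTheorySymbols in
/-- An odd modulus coprime to `a` for which `a ^ 2` is congruent to an odd power of `2` is
congruent to `±1` modulo `8`. -/
theorem natAbs_mod_eight_of_dvd_two_pow_sub_sq {a b : ℤ} {m : ℕ} (hb : Odd b) (hm : Odd m)
    (hab : IsCoprime a b) (h : b ∣ 2 ^ m - a ^ 2) :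
    b.natAbs % 8 = 1 ∨ b.natAbs % 8 = 7 := by
  have hb' : Odd b.natAbs := Int.natAbs_odd.mpr hb
  have hgcd : a.gcd b.natAbs = 1 := (Int.isCoprime_iff_gcd_eq_one.mp hab :)
  have hmod : (2 ^ m : ℤ) % b.natAbs = a ^ 2 % b.natAbs :=
    (Int.modEq_iff_dvd.mpr (Int.natAbs_dvd.mpr h)).symm
  have hJ : J(2 | b.natAbs) ^ m = 1 := by
    rw [← jacobiSym.pow_left, jacobiSym.mod_left' hmod, jacobiSym.sq_one' hgcd]
  rw [jacobiSym.at_two hb', ZMod.χ₈_nat_eq_if_mod_eight] at hJ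
  have := Nat.odd_iff.mp hb'
  split_ifs at hJ with _ h8
  · omega
  · exact h8
  · rw [hm.neg_one_pow] at hJ
    norm_num at hJ

theorem statement17 (ℓ : ℕ) (hℓ : ℓ.Prime) (a b : ℤ) (ha : Odd a) (hb : Odd b)
    (n : ℕ) (hn3 : 3 ≤ n) (hnodd : Odd n)
    (h : a ^ 2 + (ℓ : ℤ) * b ^ 2 = 2 ^ (n + 2)) :
    b ^ 2 % 16 = 1 ∧ (a ^ 2 % 16 = 1 ↔ ℓ % 16 = 15) := by
  have hab : IsCoprime a b := by
    have h2 : IsCoprime a (2 ^ (n + 2)) := (Int.isCoprime_two_right.mpr ha).pow_right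
    rw [← h, show a ^ 2 + (ℓ : ℤ) * b ^ 2 = (ℓ * b) * b + a * a by ring] at h2
    exact (IsCoprime.of_add_mul_left_right h2).of_mul_right_right
  have hb8 := natAbs_mod_eight_of_dvd_two_pow_sub_sq hb (hnodd.add_even even_two) hab
    ⟨ℓ * b, by rw [← h]; ring⟩
  have hb16 : b ^ 2 % 16 = 1 := by
    have : b % 16 = 1 ∨ b % 16 = 7 ∨ b % 16 = 9 ∨ b % 16 = 15 := by omega
    rcases this with h | h | h | h <;> simp [pow_two, Int.mul_emod, h]
  refine ⟨hb16, ?_⟩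
  have hsum : (a ^ 2 + ℓ) % 16 = 0 := by
    have h16 : (16 : ℤ) ∣ 2 ^ (n + 2) := pow_dvd_pow 2 (by omega : 4 ≤ n + 2)
    rw [← h] at h16
    have hmul : (ℓ : ℤ) * b ^ 2 % 16 = ℓ % 16 := by simp [Int.mul_emod, hb16]
    omega
  omega
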